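/- Let m > (ln 2)/2 and σ > 0, and for ν > 0 let M(ν) := ( ∫_0^∞ e^{ν s} e^{−(s−m)²/(2σ²)} ds ) / ( ∫_0^∞ e^{−(s−m)²/(2σ²)} ds ) be the exponential moment of the truncated normal distribution with parameters m, σ. Then there is no μ > 1 such that both M(2μ) ≤ μ² and M(μ)·(M(μ) − 1) < μ. -/

import Mathlib

open MeasureTheory Set

/-- Up to a factor at least one, the exponential tilt of a Gaussian weight is that weight
shifted to the right by `ν * σ ^ 2`. -/
theorem exp_mul_gaussian_eq (m ν s : ℝ) {σ : ℝ} (hσ : 0 < σ) :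
    Real.exp (ν * s) * Real.exp (-(s - m) ^ 2 / (2 * σ ^ 2)) =
      Real.exp (ν * m + ν ^ 2 * σ ^ 2 / 2) *
        Real.exp (-(s - ν * σ ^ 2 - m) ^ 2 / (2 * σ ^ 2)) := by
  rw [← Real.exp_add, ← Real.exp_add]
  congr 1
  field_simp
  ring

theorem integrable_exp_neg_sub_sq_div (m : ℝ) {σ : ℝ} (hσ : 0 < σ) :
    Integrable fun s : ℝ => Real.exp (-(s - m) ^ 2 / (2 * σ ^ 2)) := by
  have h := (integrable_exp_neg_mul_sq (b := 1 / (2 * σ ^ 2)) (by positivity)).comp_sub_right m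
  refine h.congr (Filter.Eventually.of_forall fun s => ?_)
  simp only
  congr 1
  ring

theorem setIntegral_Ioi_le_comp_sub_right {g : ℝ → ℝ} (hg : Integrable g) (hg0 : 0 ≤ g)
    {a c : ℝ} (hc : 0 ≤ c) :
    ∫ s in Ioi a, g s ≤ ∫ s in Ioi a, g (s - c) := by
  have hshift : ∫ s in Ioi a, g (s - c) = ∫ s in Ioi (a - c), g s := by
    simpa using (measurePreserving_sub_right volume c).setIntegral_preimage_emb
      (MeasurableEquiv.subRight c).measurableEmbedding g (Ioi (a - c))
  rw [hshift]
  exact setIntegral_mono_set hg.integrableOn (Filter.Eventually.of_forall hg0)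
    (Ioi_subset_Ioi (by linarith)).eventuallyLE

/-- The exponential moment of a normal distribution truncated to `(0, ∞)` dominates the
exponential at its location parameter. -/
theorem exp_mul_le_truncated_gaussian_moment (m : ℝ) {σ ν : ℝ} (hσ : 0 < σ) (hν : 0 ≤ ν) :
    Real.exp (ν * m) ≤
      (∫ s in Ioi (0 : ℝ), Real.exp (ν * s) * Real.exp (-(s - m) ^ 2 / (2 * σ ^ 2))) /
        (∫ s in Ioi (0 : ℝ), Real.exp (-(s - m) ^ 2 / (2 * σ ^ 2))) := by
  have hint := integrable_exp_neg_sub_sq_div m hσ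
  have hpos : 0 < ∫ s in Ioi (0 : ℝ), Real.exp (-(s - m) ^ 2 / (2 * σ ^ 2)) := by
    rw [setIntegral_pos_iff_support_of_nonneg_ae
      (Filter.Eventually.of_forall fun s => (Real.exp_pos _).le) hint.integrableOn]
    have hsupp : Function.support (fun s : ℝ => Real.exp (-(s - m) ^ 2 / (2 * σ ^ 2))) = univ :=
      Function.support_eq_univ fun s => (Real.exp_pos _).ne'
    simp [hsupp]
  rw [le_div_iff₀ hpos]
  simp_rw [exp_mul_gaussian_eq m ν _ hσ]
  rw [integral_const_mul]
  refine mul_le_mul ?_ ?_ hpos.le (Real.exp_pos _).le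
  · exact Real.exp_le_exp.2 (le_add_of_nonneg_right (by positivity))
  · exact setIntegral_Ioi_le_comp_sub_right hint (fun s => (Real.exp_pos _).le) (by positivity)

theorem sq_le_exp_mul_log_two {x : ℝ} (hx : 0 < x) (hx2 : x ≤ 2) :
    x ^ 2 ≤ Real.exp (x * Real.log 2) := by
  have hlog : Real.log x - Real.log 2 ≤ x / 2 - 1 := by
    rw [← Real.log_div hx.ne' two_ne_zero]
    exact Real.log_le_sub_one_of_pos (by positivity)
  have hexp : x ^ 2 = Real.exp (2 * Real.log x) := by
    rw [two_mul, Real.exp_add, Real.exp_log hx, sq]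
  rw [hexp, Real.exp_le_exp]
  nlinarith [Real.log_two_lt_d9]

theorem le_mul_sub_one_of_exp_le {x y : ℝ} (hx : 2 ≤ x)
    (hy : Real.exp (x * (Real.log 2 / 2)) ≤ y) : x ≤ y * (y - 1) := by
  have hsplit : Real.exp (x * (Real.log 2 / 2)) =
      2 * Real.exp ((x - 2) * (Real.log 2 / 2)) := by
    rw [show x * (Real.log 2 / 2) = Real.log 2 + (x - 2) * (Real.log 2 / 2) by ring,
      Real.exp_add, Real.exp_log two_pos]
  have htangent := Real.add_one_le_exp ((x - 2) * (Real.log 2 / 2))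
  have hlinear : 1 + x / 2 ≤ y := by nlinarith [Real.log_two_gt_d9]
  nlinarith

/-- For the normal distribution with parameters `m > (ln 2)/2`, `σ > 0`
truncated to `(0,∞)`, no `μ > 1` satisfies both hypotheses `M(2μ) ≤ μ²` and
`M(μ)(M(μ)-1) < μ` of the main decay theorem. -/
theorem stmt_18 (m σ : ℝ) (hm : Real.log 2 / 2 < m) (hσ : 0 < σ)
    (M : ℝ → ℝ)
    (hM : ∀ ν : ℝ, 0 < ν → M ν =
      (∫ s in Set.Ioi (0 : ℝ), Real.exp (ν * s) * Real.exp (-(s - m) ^ 2 / (2 * σ ^ 2))) /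
        (∫ s in Set.Ioi (0 : ℝ), Real.exp (-(s - m) ^ 2 / (2 * σ ^ 2)))) :
    ¬ ∃ μ : ℝ, 1 < μ ∧ M (2 * μ) ≤ μ ^ 2 ∧ M μ * (M μ - 1) < μ := by
  rintro ⟨μ, hμ, hsq, hlt⟩
  have hexp : ∀ ν : ℝ, 0 < ν → Real.exp (ν * m) ≤ M ν := fun ν hν =>
    hM ν hν ▸ exp_mul_le_truncated_gaussian_moment m hσ hν.le
  rcases le_total μ 2 with h2 | h2
  · have hstrict : Real.exp (μ * Real.log 2) < Real.exp (2 * μ * m) :=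
      Real.exp_lt_exp.2 (by nlinarith)
    linarith [sq_le_exp_mul_log_two (by linarith) h2, hexp (2 * μ) (by linarith)]
  · have hle : Real.exp (μ * (Real.log 2 / 2)) ≤ Real.exp (μ * m) :=
      Real.exp_le_exp.2 (by nlinarith)
    exact hlt.not_ge (le_mul_sub_one_of_exp_le h2 (hle.trans (hexp μ (by linarith))))
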